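/- Let k be a field and let (V, W, f) be a representation of the two-node quiver Q : ∘ → ∘ with V and W finite-dimensional, i.e., f : V → W is k-linear. Set r = rank f, s = dim V − r, t = dim W − r. Then (V, W, f) is isomorphic, as a representation of Q, to the direct sum of r copies of Rep1 = (k → k, identity), s copies of Rep3 = (k → 0, zero map), and t copies of Rep2 = (0 → k, zero map); concretely, there exist k-linear equivalences e₁ : V ≃ (Fin r → k) × (Fin s → k) and e₂ : W ≃ (Fin r → k) × (Fin t → k) such that e₂ ∘ f = g ∘ e₁, where g sends (x, y) to (x, 0). -/

import Mathlib

/-- **Basic decomposition of a representation of `∘ → ∘`.** A representation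
`(V, W, f)` of the two-node one-arrow quiver with `r = rank f`, `s = dim V - r`,
`t = dim W - r` is isomorphic to `r` copies of `Rep1 = (k → k, id)`, plus
`s` copies of `Rep3 = (k → 0, 0)`, plus `t` copies of `Rep2 = (0 → k, 0)`:
there are linear equivalences `e₁ : V ≃ k^r × k^s` and `e₂ : W ≃ k^r × k^t`
with `e₂ ∘ f = g ∘ e₁` where `g (x, y) = (x, 0)`. -/
theorem two_node_quiver_rep_basic_decomposition
    (k : Type*) [Field k] (V W : Type*)
    [AddCommGroup V] [Module k V] [FiniteDimensional k V]
    [AddCommGroup W] [Module k W] [FiniteDimensional k W]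
    (f : V →ₗ[k] W) (r s t : ℕ)
    (hr : r = Module.finrank k (LinearMap.range f))
    (hs : s = Module.finrank k V - r)
    (ht : t = Module.finrank k W - r) :
    ∃ (e₁ : V ≃ₗ[k] (Fin r → k) × (Fin s → k))
      (e₂ : W ≃ₗ[k] (Fin r → k) × (Fin t → k)),
      ∀ v : V, e₂ (f v) = ((e₁ v).1, 0) := by
  obtain ⟨D, hD⟩ := (LinearMap.ker f).exists_isCompl
  obtain ⟨C, hC⟩ := (LinearMap.range f).exists_isCompl
  have hker : Module.finrank k (LinearMap.ker f) = s := by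
    have := f.finrank_range_add_finrank_ker
    omega
  have hcompl : Module.finrank k C = t := by
    have := Submodule.finrank_add_eq_of_isCompl hC
    omega
  let eR : LinearMap.range f ≃ₗ[k] (Fin r → k) :=
    LinearEquiv.ofFinrankEq _ _ (by simp [hr])
  let eK : LinearMap.ker f ≃ₗ[k] (Fin s → k) :=
    LinearEquiv.ofFinrankEq _ _ (by simp [hker])
  let eC : C ≃ₗ[k] (Fin t → k) :=
    LinearEquiv.ofFinrankEq _ _ (by simp [hcompl])
  let eV : V ≃ₗ[k] LinearMap.range f × LinearMap.ker f :=
    LinearMap.equivProdOfSurjectiveOfIsCompl f.rangeRestrict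
      (Submodule.projectionOnto (LinearMap.ker f) D hD)
      f.range_rangeRestrict (Submodule.range_projectionOnto hD)
      (by rwa [f.ker_rangeRestrict, Submodule.ker_projectionOnto])
  let eW : W ≃ₗ[k] LinearMap.range f × C := (Submodule.prodEquivOfIsCompl _ C hC).symm
  refine ⟨eV.trans (eR.prodCongr eK), eW.trans (eR.prodCongr eC), fun v => ?_⟩
  have hV : (eV v).1 = f.rangeRestrict v := rfl
  have hW : eW (f v) = (f.rangeRestrict v, 0) :=
    Submodule.prodEquivOfIsCompl_symm_apply_left _ C hC (f.rangeRestrict v)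
  simp [hV, hW]
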